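/- Let H be a complex Hilbert space, let Δ be a bounded, self-adjoint, positive and invertible operator on H, and let λ > 0. Then for every ξ ∈ H the function t ↦ λ^{-it}·cosh(πt)^{-1}·Δ^{it}(Δ^{-1/2}ξ) is Bochner integrable on ℝ, and (Δ + λ)^{-1} ξ = (2√λ)^{-1} ∫_ℝ λ^{-it} cosh(πt)^{-1} Δ^{it} (Δ^{-1/2} ξ) dt. -/

import Mathlib

open MeasureTheory Real

/-- The complex power `Δ^z` of an operator, via the continuous functional calculus
applied to `x ↦ x ^ z` on the spectrum. -/
noncomputable def cpowCLM {H : Type*} [NormedAddCommGroup H] [InnerProductSpace ℂ H]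
    [CompleteSpace H] (Δ : H →L[ℂ] H) (z : ℂ) : H →L[ℂ] H :=
  cfc (fun x : ℂ => x ^ z) Δ

/-- The substitution `x = sigmoid (2πt)` turns the Beta integrand at
`(1/2 + ia/(2π), 1/2 - ia/(2π))` into a character divided by `cosh (πt)`. -/
lemma sigmoid_betaIntegrand (a t : ℝ) :
    |sigmoid (2 * π * t) * (1 - sigmoid (2 * π * t)) * (2 * π)| •
      (((sigmoid (2 * π * t) : ℝ) : ℂ) ^ ((1 / 2 + Complex.I * (a / (2 * π)) : ℂ) - 1) *
        (1 - ((sigmoid (2 * π * t) : ℝ) : ℂ)) ^ ((1 / 2 - Complex.I * (a / (2 * π)) : ℂ) - 1)) =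
      (π : ℂ) * (Complex.exp (Complex.I * a * t) * ((cosh (π * t))⁻¹ : ℝ)) := by
  set s := sigmoid (2 * π * t) with hs
  have hs0 : 0 < s := sigmoid_pos _
  have hs1 : 0 < 1 - s := sub_pos.2 (sigmoid_lt_one _)
  have hπ := Real.pi_pos
  have hc : 0 < 2 * cosh (π * t) := by have := cosh_pos (π * t); positivity
  have hsum : 2 * cosh (π * t) = exp (π * t) + exp (-(π * t)) := by rw [cosh_eq]; ring
  have hmul : exp (π * t) * exp (-(π * t)) = 1 := by rw [← exp_add]; simp
  have hsq : exp (-(2 * π * t)) = exp (-(π * t)) * exp (-(π * t)) := by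
    rw [← exp_add]; ring_nf
  have h1 : s = exp (π * t - log (2 * cosh (π * t))) := by
    rw [exp_sub, exp_log hc, hs, sigmoid_def, hsum, hsq, inv_eq_one_div,
      div_eq_div_iff (by positivity) (by positivity)]
    linear_combination -exp (-(π * t)) * hmul
  have h2 : 1 - s = exp (-(π * t) - log (2 * cosh (π * t))) := by
    rw [h1, exp_sub, exp_sub, exp_log hc, sub_eq_iff_eq_add, ← add_div, eq_div_iff hc.ne', hsum]
    ring
  have l1 : log s = π * t - log (2 * cosh (π * t)) := by rw [h1, log_exp]
  have l2 : log (1 - s) = -(π * t) - log (2 * cosh (π * t)) := by rw [h2, log_exp]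
  have e1 : (2 * (cosh (π * t) : ℂ))⁻¹ = Complex.exp (-(log (2 * cosh (π * t)) : ℝ)) := by
    rw [← Complex.ofReal_neg, ← Complex.ofReal_exp, exp_neg, exp_log hc]
    push_cast; rfl
  have hs0' : (s : ℂ) ≠ 0 := by exact_mod_cast hs0.ne'
  have hs1' : ((1 - s : ℝ) : ℂ) ≠ 0 := by exact_mod_cast hs1.ne'
  have hπ' : (π : ℂ) ≠ 0 := by exact_mod_cast hπ.ne'
  have e2 : (((cosh (π * t))⁻¹ : ℝ) : ℂ) = 2 * (2 * (cosh (π * t) : ℂ))⁻¹ := by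
    push_cast; rw [mul_inv]; ring
  rw [abs_of_pos (by positivity), ← Complex.ofReal_one, ← Complex.ofReal_sub, Complex.ofReal_one,
    Complex.cpow_sub _ _ hs0', Complex.cpow_sub _ _ hs1', Complex.cpow_one, Complex.cpow_one,
    Complex.real_smul, e2, e1]
  have e3 : (s : ℂ) ^ (1 / 2 + Complex.I * (a / (2 * π)) : ℂ) *
      ((1 - s : ℝ) : ℂ) ^ (1 / 2 - Complex.I * (a / (2 * π)) : ℂ) =
      Complex.exp (Complex.I * a * t) * Complex.exp (-(log (2 * cosh (π * t)) : ℝ)) := by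
    rw [Complex.cpow_def_of_ne_zero hs0', Complex.cpow_def_of_ne_zero hs1',
      ← Complex.ofReal_log hs0.le, ← Complex.ofReal_log hs1.le, l1, l2, ← Complex.exp_add,
      ← Complex.exp_add]
    congr 1
    push_cast
    field_simp
    ring
  rw [show ∀ x y z w : ℂ, x * (y / z * (w / ((1 - s : ℝ) : ℂ))) =
    x / z / ((1 - s : ℝ) : ℂ) * (y * w) by intros; field_simp, e3]
  push_cast
  rw [Complex.ofReal_sub, Complex.ofReal_one] at hs1'
  field_simp

lemma image_sigmoid_two_pi_mul : (fun t => sigmoid (2 * π * t)) '' Set.univ = Set.Ioo 0 1 := by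
  rw [Set.image_univ, ← range_sigmoid]
  have h : Function.Surjective fun t : ℝ => 2 * π * t := mul_left_surjective₀ (by positivity)
  exact h.range_comp sigmoid

lemma hasDerivAt_sigmoid_two_pi_mul (t : ℝ) : HasDerivAt (fun t => sigmoid (2 * π * t))
    (sigmoid (2 * π * t) * (1 - sigmoid (2 * π * t)) * (2 * π)) t := by
  simpa [Function.comp_def] using
    (hasDerivAt_sigmoid (2 * π * t)).comp t ((hasDerivAt_id t).const_mul (2 * π))

lemma injective_sigmoid_two_pi_mul : Function.Injective fun t => sigmoid (2 * π * t) :=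
  sigmoid_injective.comp (mul_right_injective₀ (by positivity))

lemma integrable_exp_mul_inv_cosh (a : ℝ) :
    Integrable fun t : ℝ => Complex.exp (Complex.I * a * t) * ((cosh (π * t))⁻¹ : ℝ) := by
  have hb := Complex.betaIntegral_convergent (u := 1 / 2 + Complex.I * (a / (2 * π)))
    (v := 1 / 2 - Complex.I * (a / (2 * π)))
    (by simp [← Complex.ofReal_ofNat, ← Complex.ofReal_mul, ← Complex.ofReal_div])
    (by simp [← Complex.ofReal_ofNat, ← Complex.ofReal_mul, ← Complex.ofReal_div])
  rw [intervalIntegrable_iff_integrableOn_Ioo_of_le zero_le_one, ← image_sigmoid_two_pi_mul,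
    integrableOn_image_iff_integrableOn_abs_deriv_smul MeasurableSet.univ
      (fun t _ => (hasDerivAt_sigmoid_two_pi_mul t).hasDerivWithinAt)
      injective_sigmoid_two_pi_mul.injOn] at hb
  simp_rw [sigmoid_betaIntegrand] at hb
  rw [integrableOn_univ, integrable_const_mul_iff] at hb
  · exact hb
  · exact (by exact_mod_cast pi_ne_zero : (π : ℂ) ≠ 0).isUnit

lemma integrable_inv_cosh : Integrable fun t : ℝ => (cosh (π * t))⁻¹ := by
  simpa only [Complex.ofReal_zero, mul_zero, zero_mul, Complex.exp_zero, one_mul,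
    RCLike.re_to_complex, Complex.ofReal_re] using (integrable_exp_mul_inv_cosh 0).re

/-- The Fourier transform of the hyperbolic secant. -/
lemma integral_exp_mul_inv_cosh (a : ℝ) :
    ∫ t : ℝ, Complex.exp (Complex.I * a * t) * ((cosh (π * t))⁻¹ : ℝ) =
      ((cosh (a / 2))⁻¹ : ℝ) := by
  have hπ : (π : ℂ) ≠ 0 := by exact_mod_cast pi_ne_zero
  set u : ℂ := 1 / 2 + Complex.I * (a / (2 * π)) with hu
  have huv : 1 - u = 1 / 2 - Complex.I * (a / (2 * π)) := by rw [hu]; ring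
  have h := Complex.Gamma_mul_Gamma_eq_betaIntegral (s := u) (t := 1 - u)
    (by simp [hu, ← Complex.ofReal_ofNat, ← Complex.ofReal_mul, ← Complex.ofReal_div])
    (by simp [huv, ← Complex.ofReal_ofNat, ← Complex.ofReal_mul, ← Complex.ofReal_div])
  rw [Complex.Gamma_mul_Gamma_one_sub, add_sub_cancel, Complex.Gamma_one, one_mul,
    Complex.betaIntegral, intervalIntegral.integral_of_le zero_le_one,
    integral_Ioc_eq_integral_Ioo, ← image_sigmoid_two_pi_mul,
    integral_image_eq_integral_abs_deriv_smul MeasurableSet.univ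
      (fun t _ => (hasDerivAt_sigmoid_two_pi_mul t).hasDerivWithinAt)
      injective_sigmoid_two_pi_mul.injOn, huv, hu] at h
  simp_rw [sigmoid_betaIntegrand] at h
  rw [setIntegral_univ, integral_const_mul, div_eq_mul_inv] at h
  rw [← mul_left_cancel₀ hπ h,
    show (π : ℂ) * (1 / 2 + Complex.I * (a / (2 * π))) = (a / 2 : ℂ) * Complex.I + π / 2 by
      field_simp; ring, Complex.sin_add_pi_div_two, Complex.cos_mul_I]
  push_cast
  rfl

/-- The resolvent at `-l` of a positive number as an integral of its imaginary powers. -/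
lemma integral_cpow_mul_inv_cosh {l x : ℝ} (hl : 0 < l) (hx : 0 < x) :
    (2 * √l : ℂ)⁻¹ * ∫ t : ℝ, (l : ℂ) ^ (-(Complex.I * t)) *
      (((cosh (π * t))⁻¹ : ℝ) * ((x : ℂ) ^ (Complex.I * t) * (x : ℂ) ^ (-(1 / 2 : ℂ)))) =
      ((x : ℂ) + l)⁻¹ := by
  have hl' : (l : ℂ) ≠ 0 := by exact_mod_cast hl.ne'
  have hx' : (x : ℂ) ≠ 0 := by exact_mod_cast hx.ne'
  have hint (t : ℝ) : (l : ℂ) ^ (-(Complex.I * t)) *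
      (((cosh (π * t))⁻¹ : ℝ) * ((x : ℂ) ^ (Complex.I * t) * (x : ℂ) ^ (-(1 / 2 : ℂ)))) =
      (Complex.exp (Complex.I * (log x - log l : ℝ) * t) * ((cosh (π * t))⁻¹ : ℝ)) *
        (x : ℂ) ^ (-(1 / 2 : ℂ)) := by
    have : Complex.exp (Complex.I * (log x - log l : ℝ) * t) =
        (l : ℂ) ^ (-(Complex.I * t)) * (x : ℂ) ^ (Complex.I * t) := by
      rw [Complex.cpow_def_of_ne_zero hl', Complex.cpow_def_of_ne_zero hx', ← Complex.exp_add,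
        ← Complex.ofReal_log hl.le, ← Complex.ofReal_log hx.le]
      push_cast
      ring_nf
    rw [this]
    ring
  simp_rw [hint]
  rw [integral_mul_const, integral_exp_mul_inv_cosh]
  have hhalf : (x : ℂ) ^ (-(1 / 2 : ℂ)) = ((√x)⁻¹ : ℝ) := by
    rw [sqrt_eq_rpow, ← rpow_neg hx.le, Complex.ofReal_cpow hx.le]
    norm_num
  have hexp {y : ℝ} (hy : 0 < y) : exp (log y / 2) = √y := by
    rw [← log_sqrt hy.le, exp_log (sqrt_pos.2 hy)]
  have hcosh : cosh ((log x - log l) / 2) = (x + l) / (2 * √x * √l) := by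
    have hsx := sqrt_pos.2 hx
    have hsl := sqrt_pos.2 hl
    rw [cosh_eq, neg_div', neg_sub, sub_div, sub_div, exp_sub, exp_sub, hexp hx, hexp hl]
    field_simp
    rw [sq_sqrt hx.le, sq_sqrt hl.le]
  rw [hhalf, hcosh]
  norm_cast
  have hsx := sqrt_pos.2 hx
  have hsl := sqrt_pos.2 hl
  field_simp

open scoped ComplexOrder in
lemma ContinuousLinearMap.IsPositive.exists_pos_of_mem_spectrum {H : Type*}
    [NormedAddCommGroup H] [InnerProductSpace ℂ H] [CompleteSpace H] {Δ : H →L[ℂ] H}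
    (hpos : Δ.IsPositive) (hinv : IsUnit Δ) {z : ℂ} (hz : z ∈ spectrum ℂ Δ) :
    ∃ x : ℝ, 0 < x ∧ (x : ℂ) = z := by
  have h0 : 0 ≤ z := spectrum_nonneg_of_nonneg (Δ.nonneg_iff_isPositive.2 hpos) hz
  have hne : z ≠ 0 := fun h => spectrum.zero_notMem ℂ hinv (h ▸ hz)
  have h1 : 0 < z := lt_of_le_of_ne h0 hne.symm
  rw [Complex.pos_iff] at h1
  exact ⟨z.re, h1.1, Complex.ext rfl h1.2⟩

/-- For a bounded, self-adjoint, positive, invertible operator `Δ` on a complex Hilbert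
space and `λ > 0`, the function `t ↦ λ^{-it} cosh(πt)⁻¹ Δ^{it}(Δ^{-1/2} ξ)` is Bochner
integrable and `(Δ + λ)⁻¹ ξ = (2√λ)⁻¹ ∫ λ^{-it} cosh(πt)⁻¹ Δ^{it}(Δ^{-1/2} ξ) dt`. -/
theorem stmt1 {H : Type*} [NormedAddCommGroup H] [InnerProductSpace ℂ H] [CompleteSpace H]
    (Δ : H →L[ℂ] H) (hsa : IsSelfAdjoint Δ) (hpos : Δ.IsPositive) (hinv : IsUnit Δ)
    (l : ℝ) (hl : 0 < l) (ξ : H) :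
    Integrable (fun t : ℝ =>
      ((l : ℂ) ^ (-(Complex.I * t))) •
        (Real.cosh (Real.pi * t))⁻¹ • cpowCLM Δ (Complex.I * t) (cpowCLM Δ (-(1/2 : ℂ)) ξ)) ∧
    Ring.inverse (Δ + (l : ℂ) • 1) ξ =
      (2 * Real.sqrt l)⁻¹ •
        ∫ t : ℝ, ((l : ℂ) ^ (-(Complex.I * t))) •
          (Real.cosh (Real.pi * t))⁻¹ • cpowCLM Δ (Complex.I * t) (cpowCLM Δ (-(1/2 : ℂ)) ξ) := by
  have hspec {z : ℂ} (hz : z ∈ spectrum ℂ Δ) : ∃ x : ℝ, 0 < x ∧ (x : ℂ) = z :=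
    hpos.exists_pos_of_mem_spectrum hinv hz
  have hslit {z : ℂ} (hz : z ∈ spectrum ℂ Δ) : z ∈ Complex.slitPlane := by
    obtain ⟨x, hx, rfl⟩ := hspec hz
    exact Complex.ofReal_mem_slitPlane.2 hx
  have hl' : (l : ℂ) ∈ Complex.slitPlane := Complex.ofReal_mem_slitPlane.2 hl
  have hpow (w : ℂ) : ContinuousOn (fun z : ℂ => z ^ w) (spectrum ℂ Δ) :=
    fun z hz => (continuousAt_id.cpow continuousAt_const (hslit hz)).continuousWithinAt
  let F : ℝ → ℂ → ℂ := fun t z => (l : ℂ) ^ (-(Complex.I * t)) *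
      (((cosh (π * t))⁻¹ : ℝ) * (z ^ (Complex.I * t) * z ^ (-(1 / 2 : ℂ))))
  have hF : ContinuousOn (Function.uncurry F) (Set.univ ×ˢ spectrum ℂ Δ) := by
    rintro ⟨t, z⟩ ⟨-, hz⟩
    have hz' : z ∈ Complex.slitPlane := hslit hz
    refine ContinuousAt.continuousWithinAt ?_
    refine ContinuousAt.mul ?_ (ContinuousAt.mul ?_ (ContinuousAt.mul ?_ ?_))
    · exact ContinuousAt.cpow (by fun_prop) (by fun_prop) hl'
    · refine Complex.continuous_ofReal.continuousAt.comp (ContinuousAt.inv₀ ?_ (cosh_pos _).ne')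
      exact (continuous_cosh.comp (by fun_prop)).continuousAt
    · exact ContinuousAt.cpow (by fun_prop) (by fun_prop) hz'
    · exact ContinuousAt.cpow (by fun_prop) (by fun_prop) hz'
  obtain ⟨C, hC⟩ := (spectrum.isCompact (𝕜 := ℂ) Δ).exists_bound_of_continuousOn
    (hpow (-(1 / 2 : ℂ)))
  have hbound : ∀ᵐ t : ℝ, ∀ z ∈ spectrum ℂ Δ, ‖F t z‖ ≤ (cosh (π * t))⁻¹ * C := by
    refine .of_forall fun t z hz => ?_
    obtain ⟨x, hx, rfl⟩ := hspec hz
    have h1 : ‖(l : ℂ) ^ (-(Complex.I * t))‖ = 1 := by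
      rw [Complex.norm_cpow_eq_rpow_re_of_pos hl]; simp
    have h2 : ‖(x : ℂ) ^ (Complex.I * t)‖ = 1 := by
      rw [Complex.norm_cpow_eq_rpow_re_of_pos hx]; simp
    have hc := inv_pos.2 (cosh_pos (π * t))
    simp only [F]
    rw [norm_mul, norm_mul, norm_mul, h1, h2, one_mul, one_mul, Complex.norm_real,
      Real.norm_of_nonneg hc.le]
    exact mul_le_mul_of_nonneg_left (hC _ hz) hc.le
  have hfin := (integrable_inv_cosh.mul_const C).hasFiniteIntegral
  have hnormal : IsStarNormal Δ := hsa.isStarNormal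
  have hcfc (t : ℝ) : cfc (F t) Δ ξ = ((l : ℂ) ^ (-(Complex.I * t))) •
      (cosh (π * t))⁻¹ • cpowCLM Δ (Complex.I * t) (cpowCLM Δ (-(1/2 : ℂ)) ξ) := by
    have hm : ContinuousOn (fun z : ℂ => z ^ (Complex.I * t) * z ^ (-(1 / 2 : ℂ)))
        (spectrum ℂ Δ) := (hpow (Complex.I * t)).mul (hpow (-(1 / 2 : ℂ)))
    simp only [F]
    rw [cfc_const_mul _ _ Δ (hm.const_mul _), cfc_const_mul _ _ Δ hm,
      cfc_mul _ _ Δ (hpow _) (hpow _)]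
    simp only [cpowCLM, _root_.smul_apply, mul_apply_eq_comp, Complex.coe_smul]
  have hint := integrable_cfc F _ Δ hF hbound hfin
  have hres : Ring.inverse (Δ + (l : ℂ) • 1) = (2 * √l)⁻¹ • ∫ t, cfc (F t) Δ := by
    have hsum : Δ + (l : ℂ) • 1 = cfc (fun z : ℂ => z + l) Δ := by
      rw [cfc_add_const (l : ℂ) (fun z : ℂ => z) Δ continuousOn_id, cfc_id' ℂ Δ,
        Algebra.algebraMap_eq_smul_one]
    have hne : ∀ z ∈ spectrum ℂ Δ, z + (l : ℂ) ≠ 0 := by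
      intro z hz
      obtain ⟨x, hx, rfl⟩ := hspec hz
      exact_mod_cast (add_pos hx hl).ne'
    have hl0 : (2 * √l : ℂ) ≠ 0 := by exact_mod_cast (mul_pos two_pos (sqrt_pos.2 hl)).ne'
    have hFl {z : ℂ} (hz : z ∈ spectrum ℂ Δ) : (2 * √l : ℂ)⁻¹ * ∫ t, F t z = (z + l)⁻¹ := by
      obtain ⟨x, hx, rfl⟩ := hspec hz
      exact integral_cpow_mul_inv_cosh hl hx
    have hco : ContinuousOn (fun z => ∫ t, F t z) (spectrum ℂ Δ) := by
      refine ContinuousOn.congr (f := fun z : ℂ => (2 * √l : ℂ) * (z + l)⁻¹) ?_ fun z hz => ?_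
      · exact continuousOn_const.mul (ContinuousOn.inv₀ (by fun_prop) hne)
      · simp only [← hFl hz]
        rw [mul_inv_cancel_left₀ hl0]
    rw [hsum, ← cfc_inv _ Δ hne, ← cfc_integral F _ Δ hF hbound hfin,
      ← Complex.coe_smul (2 * √l)⁻¹, ← cfc_const_mul _ _ Δ hco]
    refine cfc_congr fun z hz => ?_
    push_cast
    exact (hFl hz).symm
  simp_rw [← hcfc]
  refine ⟨hint.apply_continuousLinearMap ξ, ?_⟩
  rw [hres, _root_.smul_apply, ContinuousLinearMap.integral_apply hint]
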